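/- For the case k = 1, the forcing polynomial of CHS({1;1}_{s=1}^m | {1;1}_{t=1}^{m'}), i.e., the hexagonal chain consisting of a vertical column of m hexagons pasted to a vertical column of m' hexagons at a shared turning hexagon (a single 'L'-shaped / straight chain of m + m' − 1 hexagons meeting in one hexagon), equals m·m'·x^2 + x. -/

import Mathlib

open SimpleGraph

/-- `M` is a perfect matching of the graph `G` restricted to the vertex set `A`:
a set of pairwise disjoint edges of `G`, with all endpoints in `A`, covering every
vertex of `A`. -/
def IsPMOn {V : Type*} (G : SimpleGraph V) (A : Set V) (M : Set (Sym2 V)) : Prop :=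
  M ⊆ G.edgeSet ∧ (∀ e ∈ M, ∀ v ∈ e, v ∈ A) ∧
    (M.Pairwise fun e f => ∀ v, v ∈ e → v ∉ f) ∧ (∀ v ∈ A, ∃ e ∈ M, v ∈ e)

/-- `S` is a forcing set of the perfect matching `M` of `G` (restricted to `A`):
`S ⊆ M` and `M` is the unique perfect matching containing `S`. -/
def IsForcingOn {V : Type*} (G : SimpleGraph V) (A : Set V) (M S : Set (Sym2 V)) : Prop :=
  S ⊆ M ∧ ∀ M', IsPMOn G A M' → S ⊆ M' → M' = M

/-- The forcing number of a perfect matching: minimum size of a forcing set. -/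
noncomputable def forcingNumOn {V : Type*} (G : SimpleGraph V) (A : Set V)
    (M : Set (Sym2 V)) : ℕ :=
  sInf {n | ∃ S, IsForcingOn G A M S ∧ S.ncard = n}

/-- Vertices remaining after deleting the endpoints of edges in `S`. -/
def delVerts {V : Type*} (S : Set (Sym2 V)) : Set V := {v | ∀ e ∈ S, v ∉ e}

/-- A closed walk `c` is an `M`-alternating cycle: it is a cycle and its edges
alternate between `M` and its complement (including around the wrap). -/
def IsAltCycle {V : Type*} (G : SimpleGraph V) (M : Set (Sym2 V)) {v : V}
    (c : G.Walk v v) : Prop :=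
  c.IsCycle ∧ c.edges.Chain' (fun e f => e ∈ M ↔ f ∉ M) ∧
    ∀ e f, c.edges.head? = some e → c.edges.getLast? = some f → (f ∈ M ↔ e ∉ M)

/-- The six vertices of the hexagon with bottom-left corner `c` in the
brick-wall representation of the hexagonal lattice. -/
def hexVerts (c : ℤ × ℤ) : Set (ℤ × ℤ) :=
  {(c.1, c.2), (c.1 + 1, c.2), (c.1 + 2, c.2),
   (c.1, c.2 + 1), (c.1 + 1, c.2 + 1), (c.1 + 2, c.2 + 1)}

/-- Adjacency in the brick-wall hexagonal lattice: horizontal neighbours always,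
vertical neighbours when the parity condition holds. -/
def brickAdj (u v : ℤ × ℤ) : Prop :=
  (u.2 = v.2 ∧ (u.1 = v.1 + 1 ∨ v.1 = u.1 + 1)) ∨
    (u.1 = v.1 ∧ ((u.2 = v.2 + 1 ∧ Even (u.1 + v.2)) ∨ (v.2 = u.2 + 1 ∧ Even (u.1 + u.2))))

/-- The hexagonal system determined by a set `H` of hexagon corners: the union of
the corresponding hexagons, as a subgraph of the hexagonal (brick-wall) lattice. -/
def hexGraph (H : Set (ℤ × ℤ)) : SimpleGraph (ℤ × ℤ) :=
  SimpleGraph.fromRel fun u v =>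
    brickAdj u v ∧ ∃ c ∈ H, u ∈ hexVerts c ∧ v ∈ hexVerts c

/-- Vertex set of the hexagonal system with hexagon set `H`. -/
def hexVertexSet (H : Set (ℤ × ℤ)) : Set (ℤ × ℤ) := ⋃ c ∈ H, hexVerts c

/-- Perfect matchings of the hexagonal system with hexagon set `H`. -/
def hexPM (H : Set (ℤ × ℤ)) (M : Set (Sym2 (ℤ × ℤ))) : Prop :=
  IsPMOn (hexGraph H) (hexVertexSet H) M

/-- Forcing number of a perfect matching of a hexagonal system. -/
noncomputable def hexForcingNum (H : Set (ℤ × ℤ)) (M : Set (Sym2 (ℤ × ℤ))) : ℕ :=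
  forcingNumOn (hexGraph H) (hexVertexSet H) M

/-- `hexOmega H i` is the number of perfect matchings with forcing number `i`,
i.e. the coefficient of `x^i` in the forcing polynomial. -/
noncomputable def hexOmega (H : Set (ℤ × ℤ)) (i : ℕ) : ℕ :=
  {M | hexPM H M ∧ hexForcingNum H M = i}.ncard

/-- `CHS({1;1}ₛ₌₁ᵐ | {1;1}ₜ₌₁ᵐ′)`: one turning hexagon with an oblique column of
`m − 1` hexagons attached above it and an oblique column of `m' − 1` hexagons
attached below it (a chain of `m + m' − 1` hexagons with one turning). -/
def lShape (m m' : ℕ) : Set (ℤ × ℤ) :=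
  {((0 : ℤ), (0 : ℤ))} ∪
    {p | ∃ t : ℕ, 1 ≤ t ∧ t ≤ m - 1 ∧ p = ((t : ℤ), (t : ℤ))} ∪
    {p | ∃ t : ℕ, 1 ≤ t ∧ t ≤ m' - 1 ∧ p = ((t : ℤ), -(t : ℤ))}

/-! ### Edge sets described by two predicates on the lattice -/

/-- Edges given by vertical predicate `U` and horizontal predicate `H`. -/
def edgesOf (U H : ℤ → ℤ → Prop) : Set (Sym2 (ℤ × ℤ)) :=
  {e | ∃ x y, (e = s((x, y), (x, y + 1)) ∧ U x y) ∨ (e = s((x, y), (x + 1, y)) ∧ H x y)}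

theorem mem_edgesOf_vert (U H : ℤ → ℤ → Prop) (x y : ℤ) :
    s((x, y), (x, y + 1)) ∈ edgesOf U H ↔ U x y := by
  constructor
  · rintro ⟨x', y', h | h⟩
    · obtain ⟨h1, h2⟩ := h
      simp only [Sym2.eq_iff, Prod.mk.injEq] at h1
      obtain ⟨rfl, rfl⟩ : x = x' ∧ y = y' := by omega
      exact h2
    · obtain ⟨h1, h2⟩ := h
      simp only [Sym2.eq_iff, Prod.mk.injEq] at h1
      omega
  · intro h
    exact ⟨x, y, Or.inl ⟨rfl, h⟩⟩

theorem mem_edgesOf_hor (U H : ℤ → ℤ → Prop) (x y : ℤ) :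
    s((x, y), (x + 1, y)) ∈ edgesOf U H ↔ H x y := by
  constructor
  · rintro ⟨x', y', h | h⟩
    · obtain ⟨h1, h2⟩ := h
      simp only [Sym2.eq_iff, Prod.mk.injEq] at h1
      omega
    · obtain ⟨h1, h2⟩ := h
      simp only [Sym2.eq_iff, Prod.mk.injEq] at h1
      obtain ⟨rfl, rfl⟩ : x = x' ∧ y = y' := by omega
      exact h2
  · intro h
    exact ⟨x, y, Or.inr ⟨rfl, h⟩⟩

/-- Exactly one of four propositions. -/
def ExOne (A B C D : Prop) : Prop :=
  (A ∨ B ∨ C ∨ D) ∧ ¬(A ∧ B) ∧ ¬(A ∧ C) ∧ ¬(A ∧ D) ∧ ¬(B ∧ C) ∧ ¬(B ∧ D) ∧ ¬(C ∧ D)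

/-- Vertical edges of the system. -/
def UE (m m' : ℤ) (x y : ℤ) : Prop :=
  (0 ≤ y ∧ y < m ∧ (x = y ∨ x = y + 2)) ∨ (0 ≤ -y ∧ -y < m' ∧ (x = -y ∨ x = -y + 2))

/-- Horizontal edges of the system. -/
def HE (m m' : ℤ) (x y : ℤ) : Prop :=
  (1 ≤ y ∧ y ≤ m ∧ y - 1 ≤ x ∧ x ≤ y + 1 ∧ (x = y + 1 → y < m)) ∨
  (1 ≤ 1 - y ∧ 1 - y ≤ m' ∧ (1 - y) - 1 ≤ x ∧ x ≤ (1 - y) + 1 ∧ (x = (1 - y) + 1 → 1 - y < m'))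

/-- Vertices of the system. -/
def VE (m m' : ℤ) (x y : ℤ) : Prop :=
  (1 ≤ y ∧ y ≤ m ∧ y - 1 ≤ x ∧ x ≤ y + 2 ∧ (x = y + 2 → y < m)) ∨
  (1 ≤ 1 - y ∧ 1 - y ≤ m' ∧ (1 - y) - 1 ≤ x ∧ x ≤ (1 - y) + 2 ∧ (x = (1 - y) + 2 → 1 - y < m'))

theorem mem_hexVerts (x y c d : ℤ) :
    (x, y) ∈ hexVerts (c, d) ↔ c ≤ x ∧ x ≤ c + 2 ∧ d ≤ y ∧ y ≤ d + 1 := by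
  simp only [hexVerts, Set.mem_insert_iff, Set.mem_singleton_iff, Prod.mk.injEq]
  omega

theorem mem_lShape (m m' : ℕ) (hm : 2 ≤ m) (hm' : 2 ≤ m') (c d : ℤ) :
    (c, d) ∈ lShape m m' ↔ (0 ≤ c ∧ c < m ∧ d = c) ∨ (0 ≤ c ∧ c < m' ∧ d = -c) := by
  simp only [lShape, Set.mem_union, Set.mem_singleton_iff, Set.mem_setOf_eq, Prod.mk.injEq]
  constructor
  · rintro ((h | ⟨t, h⟩) | ⟨t, h⟩) <;> omega
  · rintro (h | h)
    · by_cases h0 : c = 0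
      · left; left; omega
      · left; right; exact ⟨c.toNat, by omega⟩
    · by_cases h0 : c = 0
      · left; left; omega
      · right; exact ⟨c.toNat, by omega⟩

theorem mem_hexVertexSet (m m' : ℕ) (hm : 2 ≤ m) (hm' : 2 ≤ m') (x y : ℤ) :
    (x, y) ∈ hexVertexSet (lShape m m') ↔ VE m m' x y := by
  simp only [hexVertexSet, Set.mem_iUnion, Prod.exists, exists_prop, mem_hexVerts,
    mem_lShape m m' hm hm', VE]
  constructor
  · rintro ⟨c, d, h⟩
    omega
  · intro h
    rcases h with h | h
    · by_cases h1 : x ≤ y + 1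
      · exact ⟨y - 1, y - 1, by omega⟩
      · exact ⟨y, y, by omega⟩
    · by_cases h1 : x ≤ (1 - y) + 1
      · exact ⟨-y, y, by omega⟩
      · exact ⟨1 - y, y - 1, by omega⟩

theorem adj_up (m m' : ℕ) (hm : 2 ≤ m) (hm' : 2 ≤ m') (x y : ℤ) :
    (Even (x + y) ∧ ∃ c ∈ lShape m m', (x, y) ∈ hexVerts c ∧ (x, y + 1) ∈ hexVerts c) ↔
      UE m m' x y := by
  simp only [Prod.exists, mem_hexVerts, mem_lShape m m' hm hm', UE, Int.even_iff]
  constructor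
  · rintro ⟨h0, c, d, h⟩
    omega
  · intro h
    refine ⟨by omega, ?_⟩
    rcases h with h | h
    · exact ⟨y, y, by omega⟩
    · exact ⟨-y, y, by omega⟩

theorem adj_hor (m m' : ℕ) (hm : 2 ≤ m) (hm' : 2 ≤ m') (x y : ℤ) :
    (∃ c ∈ lShape m m', (x, y) ∈ hexVerts c ∧ (x + 1, y) ∈ hexVerts c) ↔
      HE m m' x y := by
  simp only [Prod.exists, mem_hexVerts, mem_lShape m m' hm hm', HE]
  constructor
  · rintro ⟨c, d, h⟩
    omega
  · intro h
    rcases h with h | h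
    · by_cases h1 : x ≤ y
      · exact ⟨y - 1, y - 1, by omega⟩
      · exact ⟨y, y, by omega⟩
    · by_cases h1 : x ≤ (1 - y)
      · exact ⟨-y, y, by omega⟩
      · exact ⟨1 - y, y - 1, by omega⟩

theorem edgeSet_eq (m m' : ℕ) (hm : 2 ≤ m) (hm' : 2 ≤ m') :
    (hexGraph (lShape m m')).edgeSet = edgesOf (UE m m') (HE m m') := by
  ext e
  induction e using Sym2.ind with
  | _ u v =>
  obtain ⟨x, y⟩ := u
  obtain ⟨x', y'⟩ := v
  rw [SimpleGraph.mem_edgeSet, hexGraph, SimpleGraph.fromRel_adj]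
  constructor
  · have key : ∀ x y x' y' : ℤ, brickAdj (x, y) (x', y') →
        (∃ c ∈ lShape m m', (x, y) ∈ hexVerts c ∧ (x', y') ∈ hexVerts c) →
        s((x, y), (x', y')) ∈ edgesOf (UE m m') (HE m m') := by
      intro x y x' y' hb ⟨c, hc, h1, h2⟩
      simp only [brickAdj] at hb
      rcases hb with ⟨rfl, rfl | rfl⟩ | ⟨rfl, ⟨rfl, he⟩ | ⟨rfl, he⟩⟩
      · rw [Sym2.eq_swap, mem_edgesOf_hor, ← adj_hor m m' hm hm']
        exact ⟨c, hc, h2, h1⟩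
      · rw [mem_edgesOf_hor, ← adj_hor m m' hm hm']
        exact ⟨c, hc, h1, h2⟩
      · rw [Sym2.eq_swap, mem_edgesOf_vert, ← adj_up m m' hm hm']
        exact ⟨he, c, hc, h2, h1⟩
      · rw [mem_edgesOf_vert, ← adj_up m m' hm hm']
        exact ⟨he, c, hc, h1, h2⟩
    rintro ⟨_, ⟨hb, hc⟩ | ⟨hb, hc⟩⟩
    · exact key _ _ _ _ hb hc
    · rw [Sym2.eq_swap]
      exact key _ _ _ _ hb hc
  · rintro ⟨a, b, ⟨he, hu⟩ | ⟨he, hu⟩⟩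
    · rw [← adj_up m m' hm hm'] at hu
      obtain ⟨hev, c, hc, h1, h2⟩ := hu
      rw [Sym2.eq_iff] at he
      rcases he with ⟨h3, h4⟩ | ⟨h3, h4⟩ <;> rw [h3, h4]
      · refine ⟨by simp, Or.inl ⟨?_, c, hc, h1, h2⟩⟩
        exact Or.inr ⟨rfl, Or.inr ⟨rfl, hev⟩⟩
      · refine ⟨by simp, Or.inr ⟨?_, c, hc, h1, h2⟩⟩
        exact Or.inr ⟨rfl, Or.inr ⟨rfl, hev⟩⟩
    · rw [← adj_hor m m' hm hm'] at hu
      obtain ⟨c, hc, h1, h2⟩ := hu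
      rw [Sym2.eq_iff] at he
      rcases he with ⟨h3, h4⟩ | ⟨h3, h4⟩ <;> rw [h3, h4]
      · refine ⟨by simp, Or.inl ⟨?_, c, hc, h1, h2⟩⟩
        exact Or.inl ⟨rfl, Or.inr rfl⟩
      · refine ⟨by simp, Or.inr ⟨?_, c, hc, h1, h2⟩⟩
        exact Or.inl ⟨rfl, Or.inr rfl⟩

/-- The four candidate edges at a vertex. -/
theorem mem_edge_cases {U H : ℤ → ℤ → Prop} {e : Sym2 (ℤ × ℤ)} (he : e ∈ edgesOf U H) {x y : ℤ}
    (hv : (x, y) ∈ e) :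
    (e = s((x, y), (x, y + 1)) ∧ U x y) ∨ (e = s((x, y - 1), (x, y - 1 + 1)) ∧ U x (y - 1)) ∨
    (e = s((x, y), (x + 1, y)) ∧ H x y) ∨
    (e = s((x - 1, y), (x - 1 + 1, y)) ∧ H (x - 1) y) := by
  obtain ⟨a, b, ⟨rfl, h⟩ | ⟨rfl, h⟩⟩ := he
  · simp only [Sym2.mem_iff, Prod.mk.injEq] at hv
    rcases hv with ⟨rfl, rfl⟩ | ⟨rfl, rfl⟩
    · exact Or.inl ⟨rfl, h⟩
    · refine Or.inr (Or.inl ?_)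
      simpa using h
  · simp only [Sym2.mem_iff, Prod.mk.injEq] at hv
    rcases hv with ⟨rfl, rfl⟩ | ⟨rfl, rfl⟩
    · exact Or.inr (Or.inr (Or.inl ⟨rfl, h⟩))
    · refine Or.inr (Or.inr (Or.inr ?_))
      simpa using h

theorem isPM_edgesOf (m m' : ℕ) (hm : 2 ≤ m) (hm' : 2 ≤ m') (U H : ℤ → ℤ → Prop)
    (hU : ∀ x y, U x y → UE m m' x y) (hH : ∀ x y, H x y → HE m m' x y)
    (hV : ∀ x y, VE m m' x y → ExOne (U x y) (U x (y - 1)) (H x y) (H (x - 1) y)) :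
    hexPM (lShape m m') (edgesOf U H) := by
  have hend : ∀ e ∈ edgesOf U H, ∀ v ∈ e, v ∈ hexVertexSet (lShape m m') := by
    rintro e he ⟨x, y⟩ hv
    rw [mem_hexVertexSet m m' hm hm']
    rcases mem_edge_cases he hv with ⟨-, h⟩ | ⟨-, h⟩ | ⟨-, h⟩ | ⟨-, h⟩
    · have := hU _ _ h
      simp only [UE, VE] at *
      omega
    · have := hU _ _ h
      simp only [UE, VE] at *
      omega
    · have := hH _ _ h
      simp only [HE, VE] at *
      omega
    · have := hH _ _ h
      simp only [HE, VE] at *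
      omega
  refine ⟨?_, hend, ?_, ?_⟩
  · rw [edgeSet_eq m m' hm hm']
    rintro e ⟨x, y, ⟨h1, h2⟩ | ⟨h1, h2⟩⟩
    · exact ⟨x, y, Or.inl ⟨h1, hU _ _ h2⟩⟩
    · exact ⟨x, y, Or.inr ⟨h1, hH _ _ h2⟩⟩
  · rintro e he f hf hne ⟨x, y⟩ hve hvf
    apply hne
    have h1 := hV x y ((mem_hexVertexSet m m' hm hm' x y).1 (hend e he _ hve))
    have h2 := mem_edge_cases he hve
    have h3 := mem_edge_cases hf hvf
    obtain ⟨-, n1, n2, n3, n4, n5, n6⟩ := h1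
    rcases h2 with ⟨rfl, h2⟩ | ⟨rfl, h2⟩ | ⟨rfl, h2⟩ | ⟨rfl, h2⟩ <;>
    rcases h3 with ⟨rfl, h3⟩ | ⟨rfl, h3⟩ | ⟨rfl, h3⟩ | ⟨rfl, h3⟩ <;> 
      first
      | rfl
      | exact (n1 ⟨h2, h3⟩).elim
      | exact (n1 ⟨h3, h2⟩).elim
      | exact (n2 ⟨h2, h3⟩).elim
      | exact (n2 ⟨h3, h2⟩).elim
      | exact (n3 ⟨h2, h3⟩).elim
      | exact (n3 ⟨h3, h2⟩).elim
      | exact (n4 ⟨h2, h3⟩).elim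
      | exact (n4 ⟨h3, h2⟩).elim
      | exact (n5 ⟨h2, h3⟩).elim
      | exact (n5 ⟨h3, h2⟩).elim
      | exact (n6 ⟨h2, h3⟩).elim
      | exact (n6 ⟨h3, h2⟩).elim
  · rintro ⟨x, y⟩ hv
    rw [mem_hexVertexSet m m' hm hm'] at hv
    obtain ⟨h | h | h | h, -⟩ := hV x y hv
    · exact ⟨s((x, y), (x, y + 1)), (mem_edgesOf_vert _ _ _ _).2 h, by simp⟩
    · exact ⟨s((x, y - 1), (x, y - 1 + 1)), (mem_edgesOf_vert _ _ _ _).2 h, by simp⟩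
    · exact ⟨s((x, y), (x + 1, y)), (mem_edgesOf_hor _ _ _ _).2 h, by simp⟩
    · exact ⟨s((x - 1, y), (x - 1 + 1, y)), (mem_edgesOf_hor _ _ _ _).2 h, by simp⟩

theorem exOne_of_isPM (m m' : ℕ) (hm : 2 ≤ m) (hm' : 2 ≤ m') (M : Set (Sym2 (ℤ × ℤ)))
    (hM : hexPM (lShape m m') M) :
    ∃ U H : ℤ → ℤ → Prop, M = edgesOf U H ∧ (∀ x y, U x y → UE m m' x y) ∧
      (∀ x y, H x y → HE m m' x y) ∧
      (∀ x y, VE m m' x y → ExOne (U x y) (U x (y - 1)) (H x y) (H (x - 1) y)) := by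
  obtain ⟨h1, h2, h3, h4⟩ := hM
  rw [edgeSet_eq m m' hm hm'] at h1
  obtain ⟨U, hU⟩ : ∃ U : ℤ → ℤ → Prop, ∀ x y, U x y ↔ s((x, y), (x, y + 1)) ∈ M :=
    ⟨fun x y => s((x, y), (x, y + 1)) ∈ M, fun _ _ => Iff.rfl⟩
  obtain ⟨H, hH⟩ : ∃ H : ℤ → ℤ → Prop, ∀ x y, H x y ↔ s((x, y), (x + 1, y)) ∈ M :=
    ⟨fun x y => s((x, y), (x + 1, y)) ∈ M, fun _ _ => Iff.rfl⟩
  have hEq : M = edgesOf U H := by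
    ext e
    constructor
    · intro he
      obtain ⟨x, y, ⟨rfl, h⟩ | ⟨rfl, h⟩⟩ := h1 he
      · rwa [mem_edgesOf_vert, hU]
      · rwa [mem_edgesOf_hor, hH]
    · rintro ⟨x, y, ⟨rfl, h⟩ | ⟨rfl, h⟩⟩
      · rwa [← hU]
      · rwa [← hH]
  refine ⟨U, H, hEq, ?_, ?_, ?_⟩
  · intro x y h
    rw [hU] at h
    exact (mem_edgesOf_vert _ _ _ _).1 (h1 h)
  · intro x y h
    rw [hH] at h
    exact (mem_edgesOf_hor _ _ _ _).1 (h1 h)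
  · intro x y hv
    rw [← mem_hexVertexSet m m' hm hm'] at hv
    have uniq : ∀ e f, e ∈ M → f ∈ M → (x, y) ∈ e → (x, y) ∈ f → e = f := by
      intro e f he hf hve hvf
      by_contra hne
      exact h3 he hf hne _ hve hvf
    refine ⟨?_, ?_, ?_, ?_, ?_, ?_, ?_⟩
    · obtain ⟨e, he, hve⟩ := h4 _ hv
      rw [hEq] at he
      have := mem_edge_cases he hve
      tauto
    all_goals
      simp only [hU, hH]
      rintro ⟨ha, hb⟩
      have := uniq _ _ ha hb (by simp) (by simp)
      simp only [Sym2.eq_iff, Prod.mk.injEq] at this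
      omega

/-! ### The explicit matchings -/

/-- Vertical edges in one column, with threshold `a`. -/
def colU (n a : ℤ) (x y : ℤ) : Prop :=
  0 ≤ y ∧ y < n ∧ ((y < a ∧ x = y) ∨ (a ≤ y ∧ x = y + 2))

/-- Horizontal edges in one column, with threshold `a`. -/
def colH (n a : ℤ) (x y : ℤ) : Prop :=
  1 ≤ y ∧ y ≤ n ∧ ((y < a ∧ x = y + 1) ∨ (y = a ∧ x = y) ∨ (a < y ∧ x = y - 1))

/-- The matching with thresholds `a` and `b`. -/
def matching (m m' a b : ℕ) : Set (Sym2 (ℤ × ℤ)) :=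
  edgesOf (fun x y => colU m a x y ∨ colU m' b x (-y)) (fun x y => colH m a x y ∨ colH m' b x (1 - y))

theorem matching_isPM (m m' : ℕ) (hm : 2 ≤ m) (hm' : 2 ≤ m') (a b : ℕ) (ha : a ≤ m) (hb : b ≤ m')
    (hab : a = 0 ↔ b = 0) : hexPM (lShape m m') (matching m m' a b) := by
  apply isPM_edgesOf m m' hm hm'
  · intro x y h
    simp only [UE, colU] at *
    omega
  · intro x y h
    simp only [HE, colH] at *
    omega
  · intro x y h
    simp only [VE, colU, colH, ExOne] at *
    refine ⟨?_, ?_, ?_, ?_, ?_, ?_, ?_⟩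
    · rcases h with h | h
      · have hx : x = y - 1 ∨ x = y ∨ x = y + 1 ∨ x = y + 2 := by omega
        rcases hx with hx | hx | hx | hx <;> rcases lt_trichotomy y a with h' | h' | h' <;> grind
      · have hx : x = -y ∨ x = 1 - y ∨ x = 2 - y ∨ x = 3 - y := by omega
        rcases hx with hx | hx | hx | hx <;>
          rcases lt_trichotomy (1 - y) b with h' | h' | h' <;> grind
    all_goals
      rintro ⟨h1 | h1, h2 | h2⟩ <;> omega

theorem matching_finite (m m' a b : ℕ) : (matching m m' a b).Finite := by
  have hf : ((Set.Icc (-(m + m' + 5 : ℤ)) (m + m' + 5) ×ˢ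
      Set.Icc (-(m + m' + 5 : ℤ)) (m + m' + 5)) : Set (ℤ × ℤ)).Finite :=
    (Set.finite_Icc _ _).prod (Set.finite_Icc _ _)
  refine ((hf.image fun p => s((p.1, p.2), (p.1, p.2 + 1))).union
    (hf.image fun p => s((p.1, p.2), (p.1 + 1, p.2)))).subset ?_
  rintro e ⟨x, y, ⟨rfl, h⟩ | ⟨rfl, h⟩⟩
  · left
    refine ⟨(x, y), ?_, rfl⟩
    simp only [colU, Set.mem_prod, Set.mem_Icc] at *
    omega
  · right
    refine ⟨(x, y), ?_, rfl⟩
    simp only [colH, Set.mem_prod, Set.mem_Icc] at *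
    omega

theorem column_structure (n : ℕ) (hn : 1 ≤ n) (L R h0 h1 h2 : ℕ → Prop)
    (c0 : ∀ t < n, (L t ∨ h0 t) ∧ ¬(L t ∧ h0 t))
    (c1 : ∀ t < n, (L (t + 1) ∨ h0 t ∨ h1 t) ∧ ¬(L (t + 1) ∧ h0 t) ∧ ¬(L (t + 1) ∧ h1 t) ∧
      ¬(h0 t ∧ h1 t))
    (c2 : ∀ t < n, (R t ∨ h1 t ∨ h2 t) ∧ ¬(R t ∧ h1 t) ∧ ¬(R t ∧ h2 t) ∧ ¬(h1 t ∧ h2 t))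
    (c3 : ∀ t, t + 1 < n → (R (t + 1) ∨ h2 t) ∧ ¬(R (t + 1) ∧ h2 t))
    (hL : ¬ L n) (hh : ¬ h2 (n - 1)) :
    ∃ a ≤ n, ∀ t < n, (t < a → L t) ∧ (a ≤ t → R t) ∧ (t + 1 < a → h2 t) ∧ (t + 1 = a → h1 t) ∧
      (a < t + 1 → h0 t) := by
  have hx : ∀ k, k < n → (L (n - 1 - k) ∨ R (n - 1 - k)) ∧ ¬(L (n - 1 - k) ∧ R (n - 1 - k)) := by
    intro k
    induction k with
    | zero =>
      intro hk
      have e : n - 1 + 1 = n := by omega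
      have a0 := c0 (n - 1) (by omega)
      have a1 := c1 (n - 1) (by omega)
      have a2 := c2 (n - 1) (by omega)
      rw [e] at a1
      simp only [Nat.sub_zero]
      grind
    | succ k ih =>
      intro hk
      have ih := ih (by omega)
      have e : n - 1 - k = (n - 1 - (k + 1)) + 1 := by omega
      rw [e] at ih
      have a0 := c0 (n - 1 - (k + 1)) (by omega)
      have a1 := c1 (n - 1 - (k + 1)) (by omega)
      have a2 := c2 (n - 1 - (k + 1)) (by omega)
      have a3 := c3 (n - 1 - (k + 1)) (by omega)
      generalize n - 1 - (k + 1) = t at *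
      grind
  have hx : ∀ t < n, (L t ∨ R t) ∧ ¬(L t ∧ R t) := by
    intro t ht
    have := hx (n - 1 - t) (by omega)
    rwa [show n - 1 - (n - 1 - t) = t by omega] at this
  have hstep : ∀ t, t + 1 < n → R t → R (t + 1) := by
    intro t ht
    have a0 := c0 t (by omega)
    have a1 := c1 t (by omega)
    have a2 := c2 t (by omega)
    have a3 := c3 t (by omega)
    have a4 := hx t (by omega)
    grind
  have hex : ∃ a, a = n ∨ R a := ⟨n, Or.inl rfl⟩
  classical
  obtain ⟨a, ha1, ha2⟩ : ∃ a, (a = n ∨ R a) ∧ ∀ t < a, ¬ (t = n ∨ R t) :=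
    ⟨Nat.find hex, Nat.find_spec hex, fun t ht => Nat.find_min hex ht⟩
  have han : a ≤ n := by
    by_contra hlt
    exact ha2 n (by omega) (Or.inl rfl)
  have hRs : ∀ t, a ≤ t → t < n → R t := by
    intro t hat
    induction t, hat using Nat.le_induction with
    | base =>
      intro h
      rcases ha1 with h' | h'
      · omega
      · exact h'
    | succ t hat ih =>
      intro h
      exact hstep t h (ih (by omega))
  have hLs : ∀ t, t < a → L t := by
    intro t ht
    have := ha2 t ht
    have := hx t (by omega)
    grind
  refine ⟨a, han, fun t ht => ⟨hLs t, fun h => hRs t h ht, ?_, ?_, ?_⟩⟩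
  · intro h
    have a3 := c3 t (by omega)
    have a4 := hx (t + 1) (by omega)
    have a5 := hLs (t + 1) h
    grind
  · intro h
    have a0 := c0 t ht
    have a1 := c1 t ht
    have a5 := hLs t (by omega)
    have a6 : ¬ L (t + 1) := by
      by_cases h' : t + 1 = n
      · rwa [h']
      · have := hRs (t + 1) (by omega) (by omega)
        have := hx (t + 1) (by omega)
        grind
    grind
  · intro h
    have a0 := c0 t ht
    have a5 := hRs t (by omega) ht
    have a4 := hx t ht
    grind

theorem eq_of_isPM_subset {H : Set (ℤ × ℤ)} {M N : Set (Sym2 (ℤ × ℤ))} (hM : hexPM H M)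
    (hN : hexPM H N) (h : N ⊆ M) : M = N := by
  refine Set.Subset.antisymm ?_ h
  intro e he
  obtain ⟨v, hv⟩ : ∃ v, v ∈ e := by
    induction e using Sym2.ind with
    | _ u v => exact ⟨u, by simp⟩
  obtain ⟨f, hf, hvf⟩ := hN.2.2.2 v (hM.2.1 e he v hv)
  by_cases hef : e = f
  · rwa [hef]
  · exact absurd hvf (hM.2.2.1 he (h hf) hef v hv)

theorem exists_matching (m m' : ℕ) (hm : 2 ≤ m) (hm' : 2 ≤ m') (M : Set (Sym2 (ℤ × ℤ)))
    (hM : hexPM (lShape m m') M) :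
    ∃ a ≤ m, ∃ b ≤ m', (a = 0 ↔ b = 0) ∧ M = matching m m' a b := by
  obtain ⟨U, H, rfl, hU, hH, hV⟩ := exOne_of_isPM m m' hm hm' M hM
  have nU : ∀ x y, ¬ UE m m' x y → ¬ U x y := fun x y h h' => h (hU x y h')
  have nH : ∀ x y, ¬ HE m m' x y → ¬ H x y := fun x y h h' => h (hH x y h')
  have hup := column_structure m (by omega) (fun t => U t t) (fun t => U (t + 2) t)
    (fun t => H t (t + 1)) (fun t => H (t + 1) (t + 1)) (fun t => H (t + 2) (t + 1))
    (by
      intro t ht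
      have := hV t (t + 1) (by simp only [VE]; omega)
      have a1 := nU t (t + 1) (by simp only [UE]; omega)
      have a2 := nH (t - 1) (t + 1) (by simp only [HE]; omega)
      simp only [ExOne, add_sub_cancel_right] at this
      grind)
    (by
      intro t ht
      have := hV (t + 1) (t + 1) (by simp only [VE]; omega)
      have a1 := nU (t + 1) t (by simp only [UE]; omega)
      simp only [ExOne, add_sub_cancel_right] at this
      push_cast
      grind)
    (by
      intro t ht
      have := hV (t + 2) (t + 1) (by simp only [VE]; omega)
      have a1 := nU (t + 2) (t + 1) (by simp only [UE]; omega)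
      rw [show (t : ℤ) + 2 - 1 = t + 1 by ring] at this
      simp only [ExOne, add_sub_cancel_right] at this
      grind)
    (by
      intro t ht
      have := hV (t + 3) (t + 1) (by simp only [VE]; omega)
      have a1 := nU (t + 3) t (by simp only [UE]; omega)
      have a2 := nH (t + 3) (t + 1) (by simp only [HE]; omega)
      rw [show (t : ℤ) + 3 - 1 = t + 2 by ring] at this
      simp only [ExOne, add_sub_cancel_right] at this
      push_cast
      rw [show (t : ℤ) + 1 + 2 = t + 3 by ring]
      grind)
    (nU _ _ (by simp only [UE]; omega)) (nH _ _ (by simp only [HE]; omega))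
  have hdn := column_structure m' (by omega) (fun t => U t (-t)) (fun t => U (t + 2) (-t))
    (fun t => H t (-t)) (fun t => H (t + 1) (-t)) (fun t => H (t + 2) (-t))
    (by
      intro t ht
      have := hV t (-t) (by simp only [VE]; omega)
      have a1 := nU t (-t - 1) (by simp only [UE]; omega)
      have a2 := nH (t - 1) (-t) (by simp only [HE]; omega)
      simp only [ExOne] at this
      grind)
    (by
      intro t ht
      have := hV (t + 1) (-t) (by simp only [VE]; omega)
      have a1 := nU (t + 1) (-t) (by simp only [UE]; omega)
      simp only [ExOne, add_sub_cancel_right] at this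
      push_cast
      rw [show -((t : ℤ) + 1) = -t - 1 by ring]
      grind)
    (by
      intro t ht
      have := hV (t + 2) (-t) (by simp only [VE]; omega)
      have a1 := nU (t + 2) (-t - 1) (by simp only [UE]; omega)
      rw [show (t : ℤ) + 2 - 1 = t + 1 by ring] at this
      simp only [ExOne] at this
      grind)
    (by
      intro t ht
      have := hV (t + 3) (-t) (by simp only [VE]; omega)
      have a1 := nU (t + 3) (-t) (by simp only [UE]; omega)
      have a2 := nH (t + 3) (-t) (by simp only [HE]; omega)
      rw [show (t : ℤ) + 3 - 1 = t + 2 by ring] at this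
      simp only [ExOne] at this
      push_cast
      rw [show (t : ℤ) + 1 + 2 = t + 3 by ring, show -((t : ℤ) + 1) = -t - 1 by ring]
      grind)
    (nU _ _ (by simp only [UE]; omega)) (nH _ _ (by simp only [HE]; omega))
  obtain ⟨a, ha, hA⟩ := hup
  obtain ⟨b, hb, hB⟩ := hdn
  have hLR : ¬ (U 0 0 ∧ U 2 0) := by
    rintro ⟨hl, hr⟩
    have b1 := hV 0 0 (by simp only [VE]; omega)
    have b2 := hV 1 0 (by simp only [VE]; omega)
    have b3 := hV 2 0 (by simp only [VE]; omega)
    have b4 := hV 0 1 (by simp only [VE]; omega)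
    have b5 := hV 1 1 (by simp only [VE]; omega)
    have b6 := hV 2 1 (by simp only [VE]; omega)
    have a0 := hA 0 (by omega)
    have b0 := hB 0 (by omega)
    have n1 := nU 1 0 (by simp only [UE]; omega)
    simp only [ExOne] at *
    norm_num at *
    rcases Nat.eq_zero_or_pos a with h | h
    · have := a0.2.2.2.2 h
      grind
    · have a7 : H 2 1 ∨ H 1 1 := by
        by_cases h' : 1 < a
        · exact Or.inl (a0.2.2.1 h')
        · exact Or.inr (a0.2.2.2.1 (by omega))
      grind
  have hab : a = 0 ↔ b = 0 := by
    have a0 := hA 0 (by omega)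
    have b0 := hB 0 (by omega)
    norm_num at a0 b0
    constructor
    · intro h
      by_contra h'
      exact hLR ⟨b0.1 (by omega), a0.2.1 h⟩
    · intro h
      by_contra h'
      exact hLR ⟨a0.1 (by omega), b0.2.1 h⟩
  refine ⟨a, ha, b, hb, hab, eq_of_isPM_subset hM (matching_isPM m m' hm hm' a b ha hb hab) ?_⟩
  rintro e ⟨x, y, ⟨rfl, h⟩ | ⟨rfl, h⟩⟩
  · rw [mem_edgesOf_vert]
    rcases h with ⟨h1, h2, h3⟩ | ⟨h1, h2, h3⟩
    · obtain ⟨t, rfl⟩ := Int.eq_ofNat_of_zero_le h1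
      have := hA t (by omega)
      rcases h3 with ⟨h3, rfl⟩ | ⟨h3, rfl⟩
      · exact this.1 (by omega)
      · exact this.2.1 (by omega)
    · obtain ⟨t, ht⟩ := Int.eq_ofNat_of_zero_le h1
      have := hB t (by omega)
      rw [ht] at h3
      obtain rfl : y = -t := by omega
      rcases h3 with ⟨h3, rfl⟩ | ⟨h3, rfl⟩
      · exact this.1 (by omega)
      · exact this.2.1 (by omega)
  · rw [mem_edgesOf_hor]
    rcases h with ⟨h1, h2, h3⟩ | ⟨h1, h2, h3⟩
    · obtain ⟨t, ht⟩ := Int.eq_ofNat_of_zero_le (sub_nonneg.2 h1)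
      obtain rfl : y = t + 1 := by omega
      have := hA t (by omega)
      rcases h3 with ⟨h3, rfl⟩ | ⟨h3, rfl⟩ | ⟨h3, rfl⟩
      · have := this.2.2.1 (by omega)
        convert this using 1
        ring
      · exact this.2.2.2.1 (by omega)
      · have := this.2.2.2.2 (by omega)
        convert this using 1
    · obtain ⟨t, ht⟩ := Int.eq_ofNat_of_zero_le (sub_nonneg.2 h1)
      obtain rfl : y = -t := by omega
      have := hB t (by omega)
      rcases h3 with ⟨h3, rfl⟩ | ⟨h3, rfl⟩ | ⟨h3, rfl⟩
      · have := this.2.2.1 (by omega)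
        convert this using 1
        ring
      · have := this.2.2.2.1 (by omega)
        convert this using 1
        ring
      · have := this.2.2.2.2 (by omega)
        convert this using 1

/-! ### Distinguishing edges -/

theorem mem_matching_top (m m' a b a' b' : ℕ) (ha : 1 ≤ a) (ham : a ≤ m) :
    s(((a : ℤ), (a : ℤ)), ((a : ℤ) + 1, (a : ℤ))) ∈ matching m m' a' b' ↔ a' = a := by
  rw [matching, mem_edgesOf_hor]
  simp only [colH]
  constructor
  · rintro (h | h) <;> omega
  · rintro rfl
    exact Or.inl ⟨by omega, by omega, Or.inr (Or.inl ⟨by trivial, by trivial⟩)⟩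

theorem mem_matching_bot (m m' a b a' b' : ℕ) (hb : 1 ≤ b) (hbm : b ≤ m') :
    s(((b : ℤ), 1 - (b : ℤ)), ((b : ℤ) + 1, 1 - (b : ℤ))) ∈ matching m m' a' b' ↔ b' = b := by
  rw [matching, mem_edgesOf_hor]
  simp only [colH]
  constructor
  · rintro (h | h) <;> omega
  · rintro rfl
    exact Or.inr ⟨by omega, by omega, Or.inr (Or.inl ⟨by ring, by ring⟩)⟩

theorem mem_matching_zero (m m' a b : ℕ) (hm : 2 ≤ m) (hm' : 2 ≤ m') (hab : a = 0 ↔ b = 0) :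
    s(((2 : ℤ), (0 : ℤ)), ((2 : ℤ), (0 : ℤ) + 1)) ∈ matching m m' a b ↔ a = 0 := by
  rw [matching, mem_edgesOf_vert]
  simp only [colU]
  omega

theorem matching_inj (m m' a b a' b' : ℕ) (ha : 1 ≤ a) (ham : a ≤ m) (hb : 1 ≤ b) (hbm : b ≤ m')
    (h : matching m m' a b = matching m m' a' b') : a = a' ∧ b = b' := by
  have h1 := (mem_matching_top m m' a b a b ha ham).2 rfl
  have h2 := (mem_matching_bot m m' a b a b hb hbm).2 rfl
  rw [h] at h1 h2
  exact ⟨((mem_matching_top m m' a b a' b' ha ham).1 h1).symm,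
    ((mem_matching_bot m m' a b a' b' hb hbm).1 h2).symm⟩

/-- Changing one threshold keeps any prescribed single edge. -/
theorem exists_other (m m' a b : ℕ) (hm : 2 ≤ m) (hm' : 2 ≤ m') (ha : 1 ≤ a) (ham : a ≤ m)
    (hb : 1 ≤ b) (hbm : b ≤ m') (e : Sym2 (ℤ × ℤ)) (he : e ∈ matching m m' a b) :
    ∃ N, hexPM (lShape m m') N ∧ e ∈ N ∧ N ≠ matching m m' a b := by
  obtain ⟨a', ha'1, ha'2, ha'3⟩ : ∃ a', 1 ≤ a' ∧ a' ≤ m ∧ a' ≠ a := by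
    by_cases h : a = 1
    · exact ⟨2, by omega⟩
    · exact ⟨1, by omega⟩
  obtain ⟨b', hb'1, hb'2, hb'3⟩ : ∃ b', 1 ≤ b' ∧ b' ≤ m' ∧ b' ≠ b := by
    by_cases h : b = 1
    · exact ⟨2, by omega⟩
    · exact ⟨1, by omega⟩
  have pa := matching_isPM m m' hm hm' a' b ha'2 hbm (by omega)
  have pb := matching_isPM m m' hm hm' a b' ham hb'2 (by omega)
  have na : matching m m' a' b ≠ matching m m' a b := fun h =>
    ha'3 (matching_inj m m' a' b a b ha'1 ha'2 hb hbm h).1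
  have nb : matching m m' a b' ≠ matching m m' a b := fun h =>
    hb'3 (matching_inj m m' a b' a b ha ham hb'1 hb'2 h).2
  obtain ⟨x, y, ⟨h1, h2 | h2⟩ | ⟨h1, h2 | h2⟩⟩ := he
  · exact ⟨_, pb, ⟨x, y, Or.inl ⟨h1, Or.inl h2⟩⟩, nb⟩
  · exact ⟨_, pa, ⟨x, y, Or.inl ⟨h1, Or.inr h2⟩⟩, na⟩
  · exact ⟨_, pb, ⟨x, y, Or.inr ⟨h1, Or.inl h2⟩⟩, nb⟩
  · exact ⟨_, pa, ⟨x, y, Or.inr ⟨h1, Or.inr h2⟩⟩, na⟩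

theorem forcing_two (m m' a b : ℕ) (hm : 2 ≤ m) (hm' : 2 ≤ m') (ha : 1 ≤ a) (ham : a ≤ m)
    (hb : 1 ≤ b) (hbm : b ≤ m') : hexForcingNum (lShape m m') (matching m m' a b) = 2 := by
  have hmem : 2 ∈ {n | ∃ S, IsForcingOn (hexGraph (lShape m m')) (hexVertexSet (lShape m m'))
      (matching m m' a b) S ∧ S.ncard = n} := by
    refine ⟨{s(((a : ℤ), (a : ℤ)), ((a : ℤ) + 1, (a : ℤ))),
      s(((b : ℤ), 1 - (b : ℤ)), ((b : ℤ) + 1, 1 - (b : ℤ)))}, ⟨?_, ?_⟩, ?_⟩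
    · rintro e (rfl | rfl)
      · exact (mem_matching_top m m' a b a b ha ham).2 rfl
      · exact (mem_matching_bot m m' a b a b hb hbm).2 rfl
    · intro N hN hS
      obtain ⟨a', ha', b', hb', hab, rfl⟩ := exists_matching m m' hm hm' N hN
      have h1 := (mem_matching_top m m' a b a' b' ha ham).1 (hS (by simp))
      have h2 := (mem_matching_bot m m' a b a' b' hb hbm).1 (hS (by simp))
      rw [h1, h2]
    · apply Set.ncard_pair
      intro h
      simp only [Sym2.eq_iff, Prod.mk.injEq] at h
      omega
  apply le_antisymm (Nat.sInf_le hmem)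
  apply le_csInf ⟨2, hmem⟩
  rintro n ⟨S, ⟨hS1, hS2⟩, rfl⟩
  by_contra hlt
  have hfin : S.Finite := (matching_finite m m' a b).subset hS1
  have hle : S.ncard ≤ 1 := by omega
  have htop := (mem_matching_top m m' a b a b ha ham).2 rfl
  obtain ⟨e, he, hSe⟩ : ∃ e ∈ matching m m' a b, S ⊆ {e} := by
    rcases S.eq_empty_or_nonempty with rfl | ⟨e, he⟩
    · exact ⟨_, htop, Set.empty_subset _⟩
    · exact ⟨e, hS1 he, fun f hf => (Set.ncard_le_one hfin).1 hle f hf e he⟩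
  obtain ⟨N, hN, heN, hne⟩ := exists_other m m' a b hm hm' ha ham hb hbm e he
  apply hne
  apply hS2 N hN
  intro f hf
  rw [hSe hf]
  exact heN

theorem forcing_one (m m' : ℕ) (hm : 2 ≤ m) (hm' : 2 ≤ m') :
    hexForcingNum (lShape m m') (matching m m' 0 0) = 1 := by
  have hmem : 1 ∈ {n | ∃ S, IsForcingOn (hexGraph (lShape m m')) (hexVertexSet (lShape m m'))
      (matching m m' 0 0) S ∧ S.ncard = n} := by
    refine ⟨{s(((2 : ℤ), (0 : ℤ)), ((2 : ℤ), (0 : ℤ) + 1))}, ⟨?_, ?_⟩, Set.ncard_singleton _⟩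
    · rintro e rfl
      exact (mem_matching_zero m m' 0 0 hm hm' Iff.rfl).2 rfl
    · intro N hN hS
      obtain ⟨a', ha', b', hb', hab, rfl⟩ := exists_matching m m' hm hm' N hN
      have h1 := (mem_matching_zero m m' a' b' hm hm' hab).1 (hS rfl)
      rw [h1, hab.1 h1]
  apply le_antisymm (Nat.sInf_le hmem)
  apply le_csInf ⟨1, hmem⟩
  rintro n ⟨S, ⟨hS1, hS2⟩, rfl⟩
  by_contra hlt
  have hfin : S.Finite := (matching_finite m m' 0 0).subset hS1
  have hle : S.ncard = 0 := by omega
  rw [Set.ncard_eq_zero hfin] at hle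
  subst hle
  have := hS2 _ (matching_isPM m m' hm hm' 1 1 (by omega) (by omega) (by omega))
    (Set.empty_subset _)
  have := (matching_inj m m' 1 1 0 0 (by omega) (by omega) (by omega) (by omega) this).1
  omega

/-- The forcing polynomial of `CHS({1;1}ₛ₌₁ᵐ | {1;1}ₜ₌₁ᵐ′)` (`m, m' ≥ 2`)
is `m·m'·x² + x`. -/
theorem forcingPoly_lShape (m m' : ℕ) (hm : 2 ≤ m) (hm' : 2 ≤ m') :
    {M | hexPM (lShape m m') M ∧ hexForcingNum (lShape m m') M = 1}.ncard = 1 ∧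
    {M | hexPM (lShape m m') M ∧ hexForcingNum (lShape m m') M = 2}.ncard = m * m' ∧
    ∀ M, hexPM (lShape m m') M →
      hexForcingNum (lShape m m') M = 1 ∨ hexForcingNum (lShape m m') M = 2 := by
  refine ⟨?_, ?_, ?_⟩
  · rw [Set.ncard_eq_one]
    refine ⟨matching m m' 0 0, ?_⟩
    ext M
    constructor
    · rintro ⟨hM, hf⟩
      obtain ⟨a, ha, b, hb, hab, rfl⟩ := exists_matching m m' hm hm' M hM
      rcases Nat.eq_zero_or_pos a with h | h
      · rw [h, hab.1 h]
        rfl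
      · rw [forcing_two m m' a b hm hm' h ha (by omega) hb] at hf
        omega
    · rintro rfl
      exact ⟨matching_isPM m m' hm hm' 0 0 (by omega) (by omega) Iff.rfl, forcing_one m m' hm hm'⟩
  · have hset : {M | hexPM (lShape m m') M ∧ hexForcingNum (lShape m m') M = 2} =
        (fun p : ℕ × ℕ => matching m m' p.1 p.2) ''
          (↑(Finset.Icc 1 m ×ˢ Finset.Icc 1 m') : Set (ℕ × ℕ)) := by
      ext M
      constructor
      · rintro ⟨hM, hf⟩
        obtain ⟨a, ha, b, hb, hab, rfl⟩ := exists_matching m m' hm hm' M hM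
        rcases Nat.eq_zero_or_pos a with h | h
        · rw [h, hab.1 h, forcing_one m m' hm hm'] at hf
          omega
        · refine ⟨(a, b), ?_, rfl⟩
          simp only [Finset.mem_coe, Finset.mem_product, Finset.mem_Icc]
          omega
      · rintro ⟨⟨a, b⟩, hp, rfl⟩
        simp only [Finset.mem_coe, Finset.mem_product, Finset.mem_Icc] at hp
        exact ⟨matching_isPM m m' hm hm' a b (by omega) (by omega) (by omega),
          forcing_two m m' a b hm hm' (by omega) (by omega) (by omega) (by omega)⟩
    rw [hset, Set.ncard_image_of_injOn, Set.ncard_coe_finset]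
    · simp
    · rintro ⟨a, b⟩ hp ⟨a', b'⟩ hp' h
      simp only [Finset.mem_coe, Finset.mem_product, Finset.mem_Icc] at hp
      obtain ⟨h1, h2⟩ := matching_inj m m' a b a' b' (by omega) (by omega) (by omega) (by omega) h
      rw [h1, h2]
  · intro M hM
    obtain ⟨a, ha, b, hb, hab, rfl⟩ := exists_matching m m' hm hm' M hM
    rcases Nat.eq_zero_or_pos a with h | h
    · left
      rw [h, hab.1 h, forcing_one m m' hm hm']
    · right
      exact forcing_two m m' a b hm hm' h ha (by omega) hb
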